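/- For 2 < d < n−2, the equality N(n,d) = L(n−1,d) + L(n−1,d−1) holds if and only if (n,d) is one of (6,3), (7,3), (7,4), (8,4), (9,3), (9,6). -/

import Mathlib

/-- `w` is a necklace: lexicographically ≤ all of its rotations. -/
def IsNecklace (w : List ℕ) : Prop := ∀ i : ℕ, w ≤ w.rotate i

/-- `w` is a Lyndon word: nonempty and strictly smaller than all nontrivial rotations. -/
def IsLyndon (w : List ℕ) : Prop :=
  w ≠ [] ∧ ∀ i : ℕ, 0 < i → i < w.length → w < w.rotate i

/-- `w` is a prenecklace over the alphabet `{0,…,k-1}`. -/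
def IsPrenecklace (k : ℕ) (w : List ℕ) : Prop :=
  ∃ v : List ℕ, w <+: v ∧ (∀ a ∈ v, a < k) ∧ IsNecklace v

/-- Length of the longest prefix of `w` that is a Lyndon word. -/
noncomputable def lyn (w : List ℕ) : ℕ :=
  sSup {p | p ≤ w.length ∧ IsLyndon (w.take p)}

/-- Number of binary necklaces of length `n` and density `d`. -/
noncomputable def N (n d : ℕ) : ℕ :=
  {w : List ℕ | w.length = n ∧ (∀ a ∈ w, a < 2) ∧ w.count 1 = d ∧ IsNecklace w}.ncard

/-- Number of binary Lyndon words of length `n` and density `d`. -/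
noncomputable def L (n d : ℕ) : ℕ :=
  {w : List ℕ | w.length = n ∧ (∀ a ∈ w, a < 2) ∧ w.count 1 = d ∧ IsLyndon w}.ncard

/-- Number of necklaces over `{0,…,k-1}` with content `c`. -/
noncomputable def Nk (k : ℕ) (c : Fin k → ℕ) : ℕ :=
  {w : List ℕ | (∀ a ∈ w, a < k) ∧ (∀ i : Fin k, w.count i.val = c i) ∧ IsNecklace w}.ncard

/-- Number of Lyndon words over `{0,…,k-1}` with content `c`. -/
noncomputable def Lk (k : ℕ) (c : Fin k → ℕ) : ℕ :=
  {w : List ℕ | (∀ a ∈ w, a < k) ∧ (∀ i : Fin k, w.count i.val = c i) ∧ IsLyndon w}.ncard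

/-! Arithmetic part. -/

def chE (n k : ℕ) : ℕ := n.descFactorial k / k.factorial

def FE (n d i : ℕ) : ℕ :=
  if i * d % n = 0 then chE (Nat.gcd i n) (d * Nat.gcd i n / n) else 0

def SE (n d : ℕ) : ℕ → ℕ
  | 0 => 0
  | k + 1 => SE n d k + FE n d (k + 1)

lemma chE_eq (n k : ℕ) : chE n k = n.choose k :=
  (Nat.choose_eq_descFactorial_div_factorial n k).symm

def SGaux (n d g : ℕ) : ℕ → ℕ
  | 0 => 0
  | k + 1 => SGaux n d g k + FE n d ((k + 1) * (n / g))

/-- The sum `SE n d (n - 1)` restricted to the indices giving a nonzero term. -/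
def SG (n d : ℕ) : ℕ := SGaux n d (Nat.gcd n d) (Nat.gcd n d - 1)

lemma SE_eq_sum (n d k : ℕ) : SE n d k = ∑ i ∈ Finset.Icc 1 k, FE n d i := by
  induction k with
  | zero => simp [SE]
  | succ k ih => rw [SE, ih, Finset.sum_Icc_succ_top (by omega)]

lemma SGaux_eq_sum (n d g k : ℕ) :
    SGaux n d g k = ∑ i ∈ Finset.Icc 1 k, FE n d (i * (n / g)) := by
  induction k with
  | zero => simp [SGaux]
  | succ k ih => rw [SGaux, ih, Finset.sum_Icc_succ_top (by omega)]

lemma SE_le_SG (n d : ℕ) (hn : 0 < n) : SE n d (n - 1) ≤ SG n d := by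
  rw [SG, SE_eq_sum, SGaux_eq_sum]
  have hg0 : 0 < Nat.gcd n d := Nat.gcd_pos_of_pos_left _ hn
  obtain ⟨q, hq⟩ := Nat.gcd_dvd_left n d
  have hdiv : n / Nat.gcd n d = q := Nat.div_eq_of_eq_mul_right hg0 hq
  have hq0 : 0 < q := Nat.pos_of_ne_zero (by rintro rfl; omega)
  rw [hdiv]
  have himg : ∑ k ∈ Finset.Icc 1 (Nat.gcd n d - 1), FE n d (k * q)
      = ∑ i ∈ (Finset.Icc 1 (Nat.gcd n d - 1)).image (fun k => k * q), FE n d i := by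
    rw [Finset.sum_image]
    intro a _ b _ hab
    exact Nat.eq_of_mul_eq_mul_right hq0 hab
  rw [himg]
  refine Finset.sum_le_sum_of_ne_zero ?_
  intro i hi hne
  rw [Finset.mem_Icc] at hi
  have hmod : i * d % n = 0 := by
    by_contra hc
    exact hne (if_neg hc)
  have h1 : n ∣ i * Nat.gcd n d := by
    rw [← Nat.gcd_mul_left]
    exact Nat.dvd_gcd (Dvd.intro_left _ rfl) (Nat.dvd_of_mod_eq_zero hmod)
  obtain ⟨c, hc⟩ := h1
  have h2 : i = c * q := by
    refine Nat.eq_of_mul_eq_mul_right hg0 ?_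
    rw [hc]
    conv_lhs => rw [hq]
    ring
  rw [Finset.mem_image]
  refine ⟨c, ?_, h2.symm⟩
  rw [Finset.mem_Icc]
  constructor
  · rcases Nat.eq_zero_or_pos c with rfl | h
    · omega
    · exact h
  · have : c < Nat.gcd n d := by
      refine Nat.lt_of_mul_lt_mul_right (a := q) ?_
      rw [← h2, ← hq]
      omega
    omega

def okE (n d : ℕ) : Bool :=
  decide ((n - 1) * SG n d + n * SG (n - 1) d + n * SG (n - 1) (d - 1) < chE n d)

def excE (n d : ℕ) : Bool :=
  (n == 6 && d == 3) || (n == 7 && d == 3) || (n == 7 && d == 4) || (n == 8 && d == 4)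
   || (n == 9 && d == 3) || (n == 9 && d == 6)

lemma small_check : ∀ n < 80, ∀ d < n - 2, 2 < d → (excE n d || okE n d) = true := by
  decide +kernel

lemma choose_mono_half (a k b : ℕ) (hkb : k ≤ b) (hb : b ≤ a / 2) : a.choose k ≤ a.choose b := by
  induction b, hkb using Nat.le_induction with
  | base => exact le_rfl
  | succ b hkb ih =>
    exact (ih (by omega)).trans (Nat.choose_le_succ_of_lt_half_left (by omega))

lemma choose_mono_mid (a k b : ℕ) (hkb : k ≤ b) (hb : b + k ≤ a) : a.choose k ≤ a.choose b := by
  by_cases h : b ≤ a / 2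
  · exact choose_mono_half a k b hkb h
  · rw [← Nat.choose_symm (show b ≤ a by omega)]
    exact choose_mono_half a k (a - b) (by omega) (by omega)

lemma FE_le (n m d i D : ℕ) (hi : 0 < i) (him : i < m) (hmn : m ≤ n) (hd : d ≤ D)
    (hD : D ≤ n / 2) : FE m d i ≤ if i * d % m = 0 then (n / 2).choose (D / 2) else 0 := by
  unfold FE
  split_ifs with h
  · rw [chE_eq]
    have hg : Nat.gcd i m ≤ m / 2 := by
      have h1 : Nat.gcd i m ≤ i := Nat.gcd_le_left _ hi
      obtain ⟨q, hq⟩ := Nat.gcd_dvd_right i m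
      have : 2 ≤ q := by
        by_contra hc
        have : q = 0 ∨ q = 1 := by omega
        rcases this with rfl | rfl <;> omega
      rw [Nat.le_div_iff_mul_le (by norm_num)]
      nlinarith
    have he : d * Nat.gcd i m / m ≤ D / 2 := by
      rw [Nat.le_div_iff_mul_le (by norm_num)]
      have h2 : d * Nat.gcd i m / m * m ≤ d * Nat.gcd i m := Nat.div_mul_le_self _ _
      have h3 : 2 * Nat.gcd i m ≤ m := by omega
      have h4 : (d * Nat.gcd i m / m * 2) * m ≤ d * m := by nlinarith
      exact (Nat.le_of_mul_le_mul_right h4 (by omega)).trans hd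
    exact (Nat.choose_le_choose _ (by omega)).trans (choose_mono_half _ _ _ he (by omega))
  · exact le_rfl

lemma SE_le (n m d D : ℕ) (hd0 : 0 < d) (hm : 0 < m) (hmn : m ≤ n) (hd : d ≤ D)
    (hD : D ≤ n / 2) : SE m d (m - 1) ≤ (d - 1) * (n / 2).choose (D / 2) := by
  rw [SE_eq_sum]
  calc _ ≤ ∑ i ∈ Finset.Icc 1 (m-1), if i * d % m = 0 then (n / 2).choose (D / 2) else 0 := by
        refine Finset.sum_le_sum fun i hi => ?_
        rw [Finset.mem_Icc] at hi
        exact FE_le n m d i D (by omega) (by omega) hmn hd hD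
    _ = ((Finset.Icc 1 (m-1)).filter (fun i => i * d % m = 0)).card * (n / 2).choose (D / 2) := by
        rw [← Finset.sum_filter, Finset.sum_const, smul_eq_mul]
    _ ≤ _ := by
        refine Nat.mul_le_mul_right _ ?_
        have : (Finset.Icc 1 (d-1)).card = d - 1 := by simp
        rw [← this]
        refine Finset.card_le_card_of_injOn (fun i => i * d / m) ?_ ?_
        · intro i hi
          simp only [Finset.coe_filter, Finset.mem_Icc, Set.mem_ofPred_eq, Finset.coe_Icc,
            Set.mem_Icc] at hi ⊢
          obtain ⟨⟨h1, h2⟩, h3⟩ := hi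
          obtain ⟨c, hc⟩ := Nat.dvd_of_mod_eq_zero h3
          rw [hc, Nat.mul_div_cancel_left _ hm]
          constructor
          · rcases Nat.eq_zero_or_pos c with rfl | h
            · have : 0 < i * d := Nat.mul_pos h1 hd0
              omega
            · exact h
          · have : c < d := by
              by_contra hcon
              push Not at hcon
              have h5 : m * d ≤ m * c := Nat.mul_le_mul_left _ hcon
              have h6 : i * d < m * d := Nat.mul_lt_mul_of_pos_right (by omega) hd0
              omega
            omega
        · intro i hi j hj hij
          simp only [Finset.coe_filter, Finset.mem_Icc, Set.mem_ofPred_eq] at hi hj hij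
          have e1 := Nat.div_mul_cancel (Nat.dvd_of_mod_eq_zero hi.2)
          have e2 := Nat.div_mul_cancel (Nat.dvd_of_mod_eq_zero hj.2)
          rw [hij] at e1
          exact Nat.eq_of_mul_eq_mul_right hd0 (e1.symm.trans e2)

lemma FE_symm (n d i : ℕ) (hn : 0 < n) (hd : d ≤ n) : FE n (n - d) i = FE n d i := by
  unfold FE
  have hdv : i * (n - d) % n = 0 ↔ i * d % n = 0 := by
    rw [← Nat.dvd_iff_mod_eq_zero, ← Nat.dvd_iff_mod_eq_zero]
    have : i * (n - d) + i * d = i * n := by rw [← mul_add, Nat.sub_add_cancel hd]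
    have h2 : n ∣ i * (n - d) + i * d := this ▸ Dvd.intro_left _ rfl
    constructor
    · intro h; exact (Nat.dvd_add_right h).1 h2
    · intro h; exact (Nat.dvd_add_left h).1 h2
  by_cases h : i * d % n = 0
  · rw [if_pos h, if_pos (hdv.2 h), chE_eq, chE_eq]
    have h' : n ∣ d * Nat.gcd i n := by
      rw [← Nat.gcd_mul_left]
      exact Nat.dvd_gcd (by rw [mul_comm]; exact Nat.dvd_of_mod_eq_zero h) (Dvd.intro_left _ rfl)
    obtain ⟨e, he⟩ := h'
    have heg : e ≤ Nat.gcd i n := by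
      have : n * e ≤ n * Nat.gcd i n := by rw [← he]; exact Nat.mul_le_mul_right _ hd
      exact Nat.le_of_mul_le_mul_left this hn
    rw [Nat.sub_mul, he, ← Nat.mul_sub, Nat.mul_div_cancel_left _ hn, Nat.mul_div_cancel_left _ hn]
    exact Nat.choose_symm heg
  · rw [if_neg h, if_neg (fun h' => h (hdv.1 h'))]

lemma SE_symm (n d k : ℕ) (hn : 0 < n) (hd : d ≤ n) : SE n (n - d) k = SE n d k := by
  rw [SE_eq_sum, SE_eq_sum]
  exact Finset.sum_congr rfl fun i _ => FE_symm n d i hn hd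

lemma choose_big (a b : ℕ) (ha : 40 ≤ a) (hb : 2 ≤ b) (hba : 2 * b ≤ a + 1) :
    6 * a * (2 * b - 1) ≤ a.choose b := by
  rcases hb.eq_or_lt with rfl | hb
  · rw [Nat.choose_two_right, Nat.le_div_iff_mul_le (by norm_num)]
    obtain ⟨c, rfl⟩ := Nat.exists_eq_add_of_le ha
    have : 40 + c - 1 = 39 + c := by omega
    rw [this]; nlinarith
  · refine le_trans ?_ (choose_mono_mid a 3 b (by omega) (by omega))
    have h : 2 * b - 1 ≤ a := by omega
    refine (Nat.mul_le_mul_left _ h).trans ?_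
    rw [Nat.choose_eq_descFactorial_div_factorial, Nat.le_div_iff_mul_le (by decide)]
    obtain ⟨c, rfl⟩ := Nat.exists_eq_add_of_le ha
    have e1 : 40 + c - 1 = 39 + c := by omega
    have e2 : 40 + c - 2 = 38 + c := by omega
    simp only [Nat.descFactorial, e1, e2, Nat.factorial]
    simp only [Nat.sub_zero]
    nlinarith [Nat.zero_le (c*c), Nat.zero_le (c*c*c)]

lemma vand (n d : ℕ) : (n / 2).choose (d / 2) * ((n + 1) / 2).choose ((d + 1) / 2) ≤ n.choose d := by
  have hn : n / 2 + (n + 1) / 2 = n := by omega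
  have hd : d / 2 + (d + 1) / 2 = d := by omega
  conv_rhs => rw [← hn]
  rw [Nat.add_choose_eq]
  exact Finset.single_le_sum
    (f := fun ij : ℕ × ℕ => (n / 2).choose ij.1 * ((n + 1) / 2).choose ij.2)
    (fun _ _ => Nat.zero_le _) (a := (d / 2, (d + 1) / 2)) (by simp [hd])

lemma large_half (n d : ℕ) (hn : 80 ≤ n) (hd : 3 ≤ d) (hdn : d ≤ n / 2) :
    (n - 1) * SE n d (n - 1) + n * SE (n - 1) d (n - 2) + n * SE (n - 1) (d - 1) (n - 2)
      < n.choose d := by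
  have h1 := SE_le n n d d (by omega) (by omega) le_rfl le_rfl hdn
  have h2 := SE_le n (n-1) d d (by omega) (by omega) (by omega) le_rfl hdn
  have h3 := SE_le n (n-1) (d-1) d (by omega) (by omega) (by omega) (by omega) hdn
  have hE : n - 1 - 1 = n - 2 := by omega
  rw [hE] at h2 h3
  clear hE
  have hB : 0 < (n / 2).choose (d / 2) := Nat.choose_pos (by omega)
  have h4 := choose_big ((n+1)/2) ((d+1)/2) (by omega) (by omega) (by omega)
  have h5 := vand n d
  set B := (n / 2).choose (d / 2)
  have h6 : 3 * n * (d - 1) ≤ 6 * ((n+1)/2) * (2 * ((d+1)/2) - 1) :=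
    Nat.mul_le_mul (by omega) (by omega)
  have h7 : B * (3 * n * (d - 1)) ≤ n.choose d :=
    (Nat.mul_le_mul_left _ (h6.trans h4)).trans h5
  refine lt_of_lt_of_le ?_ h7
  obtain ⟨e, rfl⟩ : ∃ e, d = e + 2 := ⟨d - 2, by omega⟩
  obtain ⟨m, rfl⟩ : ∃ m, n = m + 1 := ⟨n - 1, by omega⟩
  simp only [Nat.add_sub_cancel, show e + 2 - 1 = e + 1 by omega] at *
  have g1 := Nat.mul_le_mul_left m h1
  have g2 := Nat.mul_le_mul_left (m+1) h2
  have g3 := Nat.mul_le_mul_left (m+1) h3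
  have g4 : 0 < (m + 1) * B := by positivity
  have g5 : 0 ≤ e * B := by positivity
  nlinarith

lemma arith_main (n d : ℕ) (hd : 2 < d) (hdn : d < n - 2) (hex : excE n d = false) :
    (n - 1) * SE n d (n - 1) + n * SE (n - 1) d (n - 2) + n * SE (n - 1) (d - 1) (n - 2)
      < n.choose d := by
  by_cases hn : n < 80
  · have := small_check n hn d hdn hd
    rw [hex, Bool.false_or, okE, decide_eq_true_eq, chE_eq] at this
    refine lt_of_le_of_lt ?_ this
    have e : n - 1 - 1 = n - 2 := by omega
    have h1 := SE_le_SG n d (by omega)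
    have h2 := SE_le_SG (n - 1) d (by omega)
    have h3 := SE_le_SG (n - 1) (d - 1) (by omega)
    rw [e] at h2 h3
    gcongr
  · by_cases h : d ≤ n / 2
    · exact large_half n d (by omega) hd h
    · have := large_half n (n - d) (by omega) (by omega) (by omega)
      rw [SE_symm n d _ (by omega) (by omega), Nat.choose_symm (by omega)] at this
      have e1 := SE_symm (n-1) (d-1) (n-2) (by omega) (by omega)
      have e2 := SE_symm (n-1) d (n-2) (by omega) (by omega)
      rw [show n - 1 - (d - 1) = n - d by omega] at e1
      rw [show n - 1 - d = n - d - 1 by omega] at e2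
      rw [e1, e2] at this
      omega

/-! Combinatorial part. -/

def wordsL : ℕ → ℕ → List (List ℕ)
  | 0, 0 => [[]]
  | 0, _ + 1 => []
  | n + 1, 0 => (wordsL n 0).map (fun w => 0 :: w)
  | n + 1, d + 1 => (wordsL n (d + 1)).map (fun w => 0 :: w) ++ (wordsL n d).map (fun w => 1 :: w)

lemma mem_wordsL (n d : ℕ) (w : List ℕ) :
    w ∈ wordsL n d ↔ w.length = n ∧ (∀ a ∈ w, a < 2) ∧ w.count 1 = d := by
  induction n generalizing d w with
  | zero =>
    cases d with
    | zero =>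
      simp only [wordsL, List.mem_singleton, List.length_eq_zero_iff]
      constructor
      · rintro rfl; simp
      · exact fun h => h.1
    | succ d =>
      simp only [wordsL, List.not_mem_nil, List.length_eq_zero_iff, false_iff]
      rintro ⟨rfl, -, h⟩
      simp at h
  | succ n ih =>
    cases w with
    | nil => cases d <;> simp [wordsL]
    | cons a w =>
      have key : ∀ x, x < 2 → x = 0 ∨ x = 1 := by omega
      cases d with
      | zero =>
        simp only [wordsL, List.mem_map, List.cons.injEq, ih, List.length_cons, List.mem_cons,
          forall_eq_or_imp, List.count_cons]
        constructor
        · rintro ⟨x, ⟨h1, h2, h3⟩, rfl, rfl⟩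
          simp [h1, h3]; exact fun a ha => Nat.le_of_lt_succ (h2 a ha)
        · rintro ⟨h1, ⟨h2, h3⟩, h4⟩
          rcases key a h2 with rfl | rfl
          · exact ⟨w, ⟨by omega, h3, by simpa using h4⟩, rfl, rfl⟩
          · simp at h4
      | succ d =>
        simp only [wordsL, List.mem_append, List.mem_map, List.cons.injEq, ih, List.length_cons,
          List.mem_cons, forall_eq_or_imp, List.count_cons]
        constructor
        · rintro (⟨x, ⟨h1, h2, h3⟩, rfl, rfl⟩ | ⟨x, ⟨h1, h2, h3⟩, rfl, rfl⟩)
          · simp [h1, h3]; exact fun a ha => Nat.le_of_lt_succ (h2 a ha)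
          · simp [h1, h3]; exact fun a ha => Nat.le_of_lt_succ (h2 a ha)
        · rintro ⟨h1, ⟨h2, h3⟩, h4⟩
          rcases key a h2 with rfl | rfl
          · exact Or.inl ⟨w, ⟨by omega, h3, by simpa using h4⟩, rfl, rfl⟩
          · exact Or.inr ⟨w, ⟨by omega, h3, by simpa using h4⟩, rfl, rfl⟩

lemma nodup_wordsL (n d : ℕ) : (wordsL n d).Nodup := by
  induction n generalizing d with
  | zero => cases d <;> simp [wordsL]
  | succ n ih =>
    have inj : ∀ a : ℕ, Function.Injective (fun w : List ℕ => a :: w) := fun a x y h => by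
      simpa using h
    cases d with
    | zero => exact (ih 0).map (inj 0)
    | succ d =>
      rw [wordsL, List.nodup_append]
      refine ⟨(ih _).map (inj 0), (ih _).map (inj 1), ?_⟩
      intro x hx y hy
      simp only [List.mem_map] at hx hy
      obtain ⟨x', -, rfl⟩ := hx
      obtain ⟨y', -, rfl⟩ := hy
      simp

lemma length_wordsL (n d : ℕ) : (wordsL n d).length = n.choose d := by
  induction n generalizing d with
  | zero => cases d <;> simp [wordsL]
  | succ n ih =>
    cases d with
    | zero => simp [wordsL, ih]
    | succ d => simp [wordsL, ih, Nat.choose_succ_succ]; omega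

def WF (n d : ℕ) : Finset (List ℕ) := (wordsL n d).toFinset

lemma mem_WF (n d : ℕ) (w : List ℕ) :
    w ∈ WF n d ↔ w.length = n ∧ (∀ a ∈ w, a < 2) ∧ w.count 1 = d := by
  rw [WF, List.mem_toFinset, mem_wordsL]

lemma card_WF (n d : ℕ) : (WF n d).card = n.choose d := by
  rw [WF, List.toFinset_card_of_nodup (nodup_wordsL n d), length_wordsL]

lemma rotate_mem_WF {n d : ℕ} {w : List ℕ} (h : w ∈ WF n d) (i : ℕ) : w.rotate i ∈ WF n d := by
  rw [mem_WF] at *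
  refine ⟨by simp [h.1], fun a ha => h.2.1 a (by simpa using ha), ?_⟩
  rw [(List.rotate_perm w i).count_eq]
  exact h.2.2

open Classical in
lemma N_eq (n d : ℕ) : N n d = ((WF n d).filter IsNecklace).card := by
  rw [N, ← Set.ncard_coe_finset]
  congr 1
  ext w
  simp [mem_WF, and_assoc]

open Classical in
lemma L_eq (n d : ℕ) : L n d = ((WF n d).filter IsLyndon).card := by
  rw [L, ← Set.ncard_coe_finset]
  congr 1
  ext w
  simp [mem_WF, and_assoc]

lemma rotate_back {w : List ℕ} {n i : ℕ} (hw : w.length = n) (hi : i ≤ n) :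
    (w.rotate i).rotate (n - i) = w := by
  rw [List.rotate_rotate, Nat.add_sub_cancel' hi, ← hw, List.rotate_length]

lemma comm_flatten (u : List ℕ) (q : ℕ) : ∀ v : List ℕ, v.length = q * u.length → u ++ v = v ++ u →
    v = (List.replicate q u).flatten := by
  induction q with
  | zero => intro v hv _; simpa using hv
  | succ q ih =>
    intro v hv h
    have hp : u <+: v := by
      have h1 : u <+: v ++ u := ⟨v, h⟩
      exact List.prefix_of_prefix_length_le h1 (List.prefix_append v u) (by rw [hv]; nlinarith)
    obtain ⟨v', rfl⟩ := hp
    rw [List.append_assoc, List.append_cancel_left_eq] at h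
    have := ih v' (by rw [List.length_append] at hv; nlinarith) h
    rw [List.replicate_succ, List.flatten_cons, ← this]

lemma rotate_gcd {w : List ℕ} {n i : ℕ} (hn : 0 < n) (hw : w.length = n) (h : w.rotate i = w) :
    w.rotate (Nat.gcd i n) = w := by
  have hk : ∀ k, w.rotate (i * k) = w := by
    intro k
    induction k with
    | zero => simp
    | succ k ih => rw [Nat.mul_succ, ← List.rotate_rotate, ih, h]
  obtain ⟨m, hm⟩ : ∃ m, i * m % n = Nat.gcd i n % n := by
    have hb := Nat.gcd_eq_gcd_ab i n
    refine ⟨((Nat.gcdA i n) % n).toNat, ?_⟩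
    have h0 : 0 ≤ (Nat.gcdA i n) % (n : ℤ) := Int.emod_nonneg _ (by omega)
    zify
    rw [Int.toNat_of_nonneg h0, hb]
    simp [Int.mul_emod]
  rw [← List.rotate_mod, hw, ← hm]
  conv_lhs => rw [← hw, List.rotate_mod]
  exact hk m

lemma rotate_flatten {w : List ℕ} {n i : ℕ} (hn : 0 < n) (hw : w.length = n)
    (h : w.rotate i = w) :
    w = (List.replicate (n / Nat.gcd i n) (w.take (Nat.gcd i n))).flatten := by
  have hg := rotate_gcd hn hw h
  set g := Nat.gcd i n with hgdef
  have hgn : g ∣ n := Nat.gcd_dvd_right i n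
  obtain ⟨q, hq⟩ := hgn
  have hg0 : 0 < g := Nat.pos_of_ne_zero (by rintro h0; rw [h0] at hq; omega)
  have hq0 : 0 < q := Nat.pos_of_ne_zero (by rintro rfl; omega)
  have hle : g ≤ w.length := by rw [hw, hq]; nlinarith
  have hdiv : n / g = q := by rw [hq, Nat.mul_div_cancel_left _ hg0]
  rw [List.rotate_eq_drop_append_take hle] at hg
  obtain ⟨r, rfl⟩ : ∃ r, q = r + 1 := ⟨q - 1, by omega⟩
  have hlen : (w.take g).length = g := by simp [hle]
  have := comm_flatten (w.take g) r (w.drop g) (by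
    rw [List.length_drop, hlen, hw, hq]
    have : g * (r + 1) = r * g + g := by ring
    omega) (by rw [hg, List.take_append_drop])
  rw [hdiv, List.replicate_succ, List.flatten_cons, ← this, List.take_append_drop]

lemma card_fix_le (n d i : ℕ) (hn : 0 < n) :
    ((WF n d).filter (fun w => w.rotate i = w)).card ≤ FE n d i := by
  have hg0 : 0 < Nat.gcd i n := Nat.gcd_pos_of_pos_right _ hn
  have hgn : Nat.gcd i n ∣ n := Nat.gcd_dvd_right i n
  have hle : Nat.gcd i n ≤ n := Nat.le_of_dvd hn hgn
  have hcount : ∀ w ∈ WF n d, w.rotate i = w →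
      d * Nat.gcd i n = n * (w.take (Nat.gcd i n)).count 1 := by
    intro w hw h
    rw [mem_WF] at hw
    have h1 := rotate_flatten hn hw.1 h
    have h2 : w.count 1 = n / Nat.gcd i n * (w.take (Nat.gcd i n)).count 1 := by
      conv_lhs => rw [h1]
      rw [List.count_flatten]
      simp
    rw [hw.2.2] at h2
    rw [h2, mul_right_comm, Nat.div_mul_cancel hgn]
  unfold FE
  split_ifs with hc
  · rw [chE_eq, ← card_WF]
    refine Finset.card_le_card_of_injOn (fun w => w.take (Nat.gcd i n)) ?_ ?_
    · intro w hw
      rw [Finset.mem_coe, Finset.mem_filter] at hw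
      have h3 := hcount w hw.1 hw.2
      obtain ⟨hw1, hw2⟩ := hw
      rw [mem_WF] at hw1
      rw [Finset.mem_coe, mem_WF]
      refine ⟨by simp [hw1.1, hle], fun a ha => hw1.2.1 a (List.mem_of_mem_take ha), ?_⟩
      rw [h3, Nat.mul_div_cancel_left _ hn]
    · intro w hw v hv h
      rw [Finset.mem_coe, Finset.mem_filter, mem_WF] at hw hv
      dsimp only at h
      rw [rotate_flatten hn hw.1.1 hw.2, rotate_flatten hn hv.1.1 hv.2, h]
  · rw [Nat.le_zero, Finset.card_eq_zero, Finset.filter_eq_empty_iff]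
    intro w hw h
    apply hc
    have h3 := hcount w hw h
    have h4 : n ∣ Nat.gcd (i * d) (n * d) := by
      rw [Nat.gcd_mul_right, mul_comm, h3]
      exact Dvd.intro _ rfl
    exact Nat.mod_eq_zero_of_dvd (h4.trans (Nat.gcd_dvd_left _ _))

lemma necklace_unique {v v' : List ℕ} {i j : ℕ} (hv : IsNecklace v) (hv' : IsNecklace v')
    (h : v.rotate i = v') (h' : v'.rotate j = v) : v = v' :=
  le_antisymm (h ▸ hv i) (h' ▸ hv' j)

lemma sum_fix_le (n d : ℕ) (hn : 0 < n) :
    ∑ i ∈ Finset.Icc 1 (n - 1), ((WF n d).filter (fun w => w.rotate i = w)).card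
      ≤ SE n d (n - 1) := by
  rw [SE_eq_sum]
  exact Finset.sum_le_sum fun i _ => card_fix_le n d i hn

open Classical in
lemma N_upper (n d : ℕ) (hn : 0 < n) : n * N n d ≤ n.choose d + SE n d (n - 1) := by
  rw [N_eq]
  have hcard : n * ((WF n d).filter IsNecklace).card
      = (((WF n d).filter IsNecklace) ×ˢ Finset.range n).card := by
    rw [Finset.card_product, Finset.card_range, mul_comm]
  rw [hcard, Finset.card_eq_sum_card_fiberwise (f := fun p => p.1.rotate p.2) (t := WF n d)]
  swap
  · intro p hp
    rw [Finset.mem_coe, Finset.mem_product, Finset.mem_filter] at hp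
    exact rotate_mem_WF hp.1.1 _
  calc _ ≤ ∑ w ∈ WF n d, ((Finset.range n).filter (fun i => w.rotate i = w)).card := by
        refine Finset.sum_le_sum fun w hw => ?_
        rcases Finset.eq_empty_or_nonempty
          ({a ∈ {w ∈ WF n d | IsNecklace w} ×ˢ Finset.range n | a.1.rotate a.2 = w}) with h0 | h0
        · rw [h0]; simp
        obtain ⟨⟨v0, i0⟩, h0⟩ := h0
        simp only [Finset.mem_filter, Finset.mem_product, Finset.mem_range, mem_WF] at h0
        obtain ⟨⟨⟨⟨hl0, -⟩, hneck0⟩, hi0⟩, hr0⟩ := h0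
        have hwl : w.length = n := ((mem_WF n d w).1 hw).1
        have hback : w.rotate (n - i0) = v0 := by rw [← hr0]; exact rotate_back hl0 hi0.le
        have huniq : ∀ v i, v.length = n → IsNecklace v → i < n → v.rotate i = w → v = v0 := by
          intro v i hl hneck hi hr
          refine necklace_unique hneck hneck0 (i := i + (n - i0)) (j := i0 + (n - i)) ?_ ?_
          · rw [← List.rotate_rotate, hr, hback]
          · rw [← List.rotate_rotate, hr0, ← hr, rotate_back hl hi.le]
        refine Finset.card_le_card_of_injOn (fun p => (p.2 + (n - i0)) % n) ?_ ?_
        · rintro ⟨v, i⟩ hp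
          simp only [Finset.coe_filter, Finset.mem_filter, Finset.mem_product, Finset.mem_range,
            mem_WF, Set.mem_ofPred_eq] at hp ⊢
          obtain ⟨⟨⟨⟨hl, -⟩, hneck⟩, hi⟩, hr⟩ := hp
          have := huniq v i hl hneck hi hr
          subst this
          refine ⟨Nat.mod_lt _ hn, ?_⟩
          conv_lhs => rw [← hwl, List.rotate_mod, hwl, add_comm, ← List.rotate_rotate, hback, hr]
        · rintro ⟨v, i⟩ hp ⟨v', i'⟩ hp' heq
          simp only [Finset.coe_filter, Finset.mem_filter, Finset.mem_product, Finset.mem_range,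
            mem_WF, Set.mem_ofPred_eq] at hp hp' heq
          obtain ⟨⟨⟨⟨hl, -⟩, hneck⟩, hi⟩, hr⟩ := hp
          obtain ⟨⟨⟨⟨hl', -⟩, hneck'⟩, hi'⟩, hr'⟩ := hp'
          have e1 := huniq v i hl hneck hi hr
          have e2 := huniq v' i' hl' hneck' hi' hr'
          have e3 : i ≡ i' [MOD n] := Nat.ModEq.add_right_cancel' (n - i0) heq
          have e4 := Nat.ModEq.eq_of_lt_of_lt e3 hi hi'
          rw [e1, e2, e4]
    _ = ∑ i ∈ Finset.range n, ((WF n d).filter (fun w => w.rotate i = w)).card := by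
        simp only [Finset.card_filter]
        exact Finset.sum_comm
    _ ≤ _ := by
        have hr : Finset.range n = insert 0 (Finset.Icc 1 (n - 1)) := by
          ext x; simp; omega
        rw [hr, Finset.sum_insert (by simp)]
        refine Nat.add_le_add ?_ (sum_fix_le n d hn)
        rw [← card_WF]
        exact Finset.card_filter_le _ _

open Classical in
lemma L_lower (n d : ℕ) (hn : 0 < n) : n.choose d ≤ n * L n d + SE n d (n - 1) := by
  rw [← card_WF, L_eq]
  have hsub : WF n d ⊆
      ((((WF n d).filter IsLyndon) ×ˢ Finset.range n).image (fun p => p.1.rotate p.2)) ∪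
      ((Finset.Icc 1 (n - 1)).biUnion (fun i => (WF n d).filter (fun w => w.rotate i = w))) := by
    intro w hw
    have hwl : w.length = n := ((mem_WF n d w).1 hw).1
    rw [Finset.mem_union]
    by_cases hp : ∃ i ∈ Finset.Icc 1 (n - 1), w.rotate i = w
    · right
      obtain ⟨i, hi, h⟩ := hp
      exact Finset.mem_biUnion.2 ⟨i, hi, Finset.mem_filter.2 ⟨hw, h⟩⟩
    · left
      push Not at hp
      obtain ⟨i, hi, hmin⟩ := Finset.exists_min_image (Finset.range n) (fun i => w.rotate i)
        ⟨0, by simpa using hn⟩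
      rw [Finset.mem_range] at hi
      rw [Finset.mem_image]
      refine ⟨(w.rotate i, (n - i) % n), ?_, ?_⟩
      · simp only [Finset.mem_product, Finset.mem_filter, Finset.mem_range]
        refine ⟨⟨rotate_mem_WF hw i, ?_, ?_⟩, Nat.mod_lt _ hn⟩
        · intro h
          have := congrArg List.length h
          simp at this
          simp [this] at hwl
          omega
        · intro j hj0 hj
          rw [List.length_rotate, hwl] at hj
          refine lt_of_le_of_ne ?_ ?_
          · have := hmin ((i + j) % n) (Finset.mem_range.2 (Nat.mod_lt _ hn))
            rw [List.rotate_rotate]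
            have e : w.rotate ((i + j) % n) = w.rotate (i + j) := by
              rw [← hwl, List.rotate_mod]
            rwa [e] at this
          · intro h
            rw [List.rotate_rotate, add_comm, ← List.rotate_rotate] at h
            exact hp j (Finset.mem_Icc.2 ⟨hj0, by omega⟩) (List.rotate_injective i h).symm
      · dsimp only
        have hl : (w.rotate i).length = n := by rw [List.length_rotate, hwl]
        have e : (w.rotate i).rotate ((n - i) % n) = (w.rotate i).rotate (n - i) := by
          conv_lhs => rw [← hl, List.rotate_mod, hl]
        rw [e, rotate_back hwl hi.le]
  refine (Finset.card_le_card hsub).trans ((Finset.card_union_le _ _).trans ?_)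
  refine Nat.add_le_add ?_ (Finset.card_biUnion_le.trans (sum_fix_le n d hn))
  refine Finset.card_image_le.trans ?_
  rw [Finset.card_product, Finset.card_range, mul_comm]

/-! Exact values in the exceptional cases. -/

def neckB (w : List ℕ) : Bool := (List.range w.length).all (fun i => decide (w ≤ w.rotate i))

def lynB (w : List ℕ) : Bool :=
  !w.isEmpty && (List.range w.length).all (fun i => i == 0 || decide (w < w.rotate i))

lemma neckB_iff (w : List ℕ) : neckB w = true ↔ IsNecklace w := by
  simp only [neckB, List.all_eq_true, List.mem_range, decide_eq_true_eq, IsNecklace]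
  constructor
  · intro h i
    rcases Nat.eq_zero_or_pos w.length with h0 | h0
    · rw [List.length_eq_zero_iff] at h0
      subst h0
      simp
    · rw [← List.rotate_mod]
      exact h _ (Nat.mod_lt _ h0)
  · intro h i _
    exact h i

lemma lynB_iff (w : List ℕ) : lynB w = true ↔ IsLyndon w := by
  simp only [lynB, Bool.and_eq_true, List.all_eq_true, List.mem_range, Bool.or_eq_true,
    decide_eq_true_eq, IsLyndon, beq_iff_eq, Bool.not_eq_true', List.isEmpty_eq_false_iff]
  refine and_congr_right fun _ => ?_
  constructor
  · intro h i hi hi'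
    exact (h i hi').resolve_left (by omega)
  · intro h i hi
    rcases Nat.eq_zero_or_pos i with h0 | h0
    · exact Or.inl h0
    · exact Or.inr (h i h0 hi)

lemma filter_card (n d : ℕ) (P : List ℕ → Prop) [DecidablePred P] (b : List ℕ → Bool)
    (h : ∀ w, b w = true ↔ P w) : ((WF n d).filter P).card = ((wordsL n d).filter b).length := by
  rw [← List.toFinset_card_of_nodup ((nodup_wordsL n d).filter _)]
  congr 1
  ext w
  simp [WF, h]

lemma N_calc (n d : ℕ) : N n d = ((wordsL n d).filter neckB).length := by
  classical
  rw [N_eq]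
  exact filter_card n d _ _ neckB_iff

lemma L_calc (n d : ℕ) : L n d = ((wordsL n d).filter lynB).length := by
  classical
  rw [L_eq]
  exact filter_card n d _ _ lynB_iff

lemma strict_main (n d : ℕ) (hd : 2 < d) (hdn : d < n - 2) (hex : excE n d = false) :
    N n d < L (n - 1) d + L (n - 1) (d - 1) := by
  have h0 := arith_main n d hd hdn hex
  have h1 := N_upper n d (by omega)
  have h2 := L_lower (n - 1) d (by omega)
  have h3 := L_lower (n - 1) (d - 1) (by omega)
  obtain ⟨e, rfl⟩ : ∃ e, d = e + 1 := ⟨d - 1, by omega⟩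
  obtain ⟨m, rfl⟩ : ∃ m, n = m + 1 := ⟨n - 1, by omega⟩
  rw [show m + 1 - 1 - 1 = m + 1 - 2 by omega] at h2 h3
  have hp : (m + 1).choose (e + 1) = m.choose e + m.choose (e + 1) := Nat.choose_succ_succ m e
  simp only [Nat.add_sub_cancel] at *
  by_contra hcon
  push Not at hcon
  have g1 := Nat.mul_le_mul_left m h1
  have g2 := Nat.mul_le_mul_left (m + 1) h2
  have g3 := Nat.mul_le_mul_left (m + 1) h3
  have g4 := Nat.mul_le_mul_left (m * (m + 1)) hcon
  rw [hp] at *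
  nlinarith

/-- For `2 < d < n-2`, equality in the Pascal-like bound holds only for six pairs. -/
theorem pascal_equality_middle (n d : ℕ) (hd : 2 < d) (hdn : d < n - 2) :
    N n d = L (n - 1) d + L (n - 1) (d - 1) ↔
      (n, d) ∈ ({(6, 3), (7, 3), (7, 4), (8, 4), (9, 3), (9, 6)} : Set (ℕ × ℕ)) := by
  constructor
  · intro h
    by_contra hc
    refine absurd h (strict_main n d hd hdn ?_).ne
    rw [← Bool.not_eq_true]
    intro hx
    apply hc
    simpa [excE, or_assoc] using hx
  · intro h
    simp only [Set.mem_insert_iff, Set.mem_singleton_iff, Prod.mk.injEq] at h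
    rcases h with ⟨rfl, rfl⟩ | ⟨rfl, rfl⟩ | ⟨rfl, rfl⟩ | ⟨rfl, rfl⟩ | ⟨rfl, rfl⟩ | ⟨rfl, rfl⟩ <;>
    · rw [N_calc, L_calc, L_calc]
      decide +kernel
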